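/- arXiv:2002.10089 — 16 statements merged into one kernel-verified Lean document; each statement's English description precedes it below -/
import Mathlib

section
/- Let h be a nonzero complex number and let (x,y) be complex numbers with Δ₊(x,y) = 4h²x²+2h²y²+hy−1 ≠ 0, with (1−h²y²)(1−8h²x²−h²y²) ≠ 0, and such that, writing (X,Y) = φ(x,y), also (1−h²Y²)(1−8h²X²−h²Y²) ≠ 0. Then H(φ(x,y)) = H(x,y), i.e. H is an invariant of the map φ. -/
open Complex

/-- The denominator `Δ₊(x,y) = 4h²x² + 2h²y² + hy − 1`. -/
def Δp (h x y : ℂ) : ℂ := 4*h^2*x^2 + 2*h^2*y^2 + h*y - 1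

/-- The map `φ(x,y) = ( x(3hy−1)/Δ₊(x,y), (4hx²−hy²−y)/Δ₊(x,y) )`. -/
noncomputable def phi (h : ℂ) (p : ℂ × ℂ) : ℂ × ℂ :=
  (p.1 * (3*h*p.2 - 1) / Δp h p.1 p.2, (4*h*p.1^2 - h*p.2^2 - p.2) / Δp h p.1 p.2)

/-- The invariant `H(x,y) = x²(x²−y²)/((1−h²y²)(1−8h²x²−h²y²))`. -/
noncomputable def H (h x y : ℂ) : ℂ :=
  x^2 * (x^2 - y^2) / ((1 - h^2*y^2) * (1 - 8*h^2*x^2 - h^2*y^2))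

theorem H_invariant_phi (h x y : ℂ) (hh : h ≠ 0)
    (hΔ : Δp h x y ≠ 0)
    (hden : (1 - h^2*y^2) * (1 - 8*h^2*x^2 - h^2*y^2) ≠ 0)
    (hden' : (1 - h^2*(phi h (x, y)).2^2) *
        (1 - 8*h^2*(phi h (x, y)).1^2 - h^2*(phi h (x, y)).2^2) ≠ 0) :
    H h (phi h (x, y)).1 (phi h (x, y)).2 = H h x y := by
  unfold H
  rw [div_eq_div_iff hden' hden]
  simp only [phi]
  field_simp
  unfold Δp
  ring
end

section
/- Let h be a nonzero complex number and let (x,y) be complex numbers with Δ₋(x,y) = 4h²x²+2h²y²−hy−1 ≠ 0, with (1−h²y²)(1−8h²x²−h²y²) ≠ 0, and such that, writing (X,Y) = ψ(x,y), also (1−h²Y²)(1−8h²X²−h²Y²) ≠ 0. Then H(ψ(x,y)) = H(x,y), i.e. H is an invariant of the map ψ. -/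
open Complex

/-- The denominator `Δ₋(x,y) = 4h²x² + 2h²y² − hy − 1`. -/
def Δm (h x y : ℂ) : ℂ := 4*h^2*x^2 + 2*h^2*y^2 - h*y - 1

/-- The map `ψ(x,y) = ( −x(3hy+1)/Δ₋(x,y), −(4hx²−hy²+y)/Δ₋(x,y) )`. -/
noncomputable def psi (h : ℂ) (p : ℂ × ℂ) : ℂ × ℂ :=
  (-(p.1 * (3*h*p.2 + 1)) / Δm h p.1 p.2, -(4*h*p.1^2 - h*p.2^2 + p.2) / Δm h p.1 p.2)

theorem H_invariant_psi (h x y : ℂ) (hh : h ≠ 0)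
    (hΔ : Δm h x y ≠ 0)
    (hden : (1 - h^2*y^2) * (1 - 8*h^2*x^2 - h^2*y^2) ≠ 0)
    (hden' : (1 - h^2*(psi h (x, y)).2^2) *
        (1 - 8*h^2*(psi h (x, y)).1^2 - h^2*(psi h (x, y)).2^2) ≠ 0) :
    H h (psi h (x, y)).1 (psi h (x, y)).2 = H h x y := by
  unfold H
  rw [div_eq_div_iff hden' hden]
  unfold psi
  dsimp only
  field_simp
  unfold Δm
  ring
end

section
/- Let h be a nonzero complex number and let (x,y) be complex numbers such that Δ₊(x,y) ≠ 0 and, writing (X,Y) = φ(x,y), also Δ₋(X,Y) ≠ 0. Then ψ(φ(x,y)) = (x,y), i.e. ψ is a left inverse of φ on the locus where both maps are defined. -/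
open Complex

theorem psi_leftInverse_phi (h x y : ℂ) (hh : h ≠ 0)
    (hΔ : Δp h x y ≠ 0)
    (hΔ' : Δm h (phi h (x, y)).1 (phi h (x, y)).2 ≠ 0) :
    psi h (phi h (x, y)) = (x, y) := by
  have hE : Δm h (x * (3*h*y - 1) / Δp h x y) ((4*h*x^2 - h*y^2 - y) / Δp h x y) ≠ 0 := hΔ'
  have hx : -(x * (3*h*y - 1) / Δp h x y * (3*h*((4*h*x^2 - h*y^2 - y) / Δp h x y) + 1)) =
      x * Δm h (x * (3*h*y - 1) / Δp h x y) ((4*h*x^2 - h*y^2 - y) / Δp h x y) := by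
    unfold Δm
    field_simp
    unfold Δp
    ring
  have hy : -(4*h*(x * (3*h*y - 1) / Δp h x y)^2 - h*((4*h*x^2 - h*y^2 - y) / Δp h x y)^2
        + (4*h*x^2 - h*y^2 - y) / Δp h x y) =
      y * Δm h (x * (3*h*y - 1) / Δp h x y) ((4*h*x^2 - h*y^2 - y) / Δp h x y) := by
    unfold Δm
    field_simp
    unfold Δp
    ring
  exact Prod.ext ((div_eq_iff hE).2 hx) ((div_eq_iff hE).2 hy)
end

section
/- Let h be a nonzero complex number and let (x,y) be complex numbers such that Δ₋(x,y) ≠ 0 and, writing (X,Y) = ψ(x,y), also Δ₊(X,Y) ≠ 0. Then φ(ψ(x,y)) = (x,y), i.e. φ is a left inverse of ψ on the locus where both maps are defined. -/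
open Complex

theorem phi_leftInverse_psi (h x y : ℂ) (hh : h ≠ 0)
    (hΔ : Δm h x y ≠ 0)
    (hΔ' : Δp h (psi h (x, y)).1 (psi h (x, y)).2 ≠ 0) :
    phi h (psi h (x, y)) = (x, y) := by
  have hX : (psi h (x, y)).1 * Δm h x y = -(x * (3*h*y + 1)) := div_mul_cancel₀ _ hΔ
  have hY : (psi h (x, y)).2 * Δm h x y = -(4*h*x^2 - h*y^2 + y) := div_mul_cancel₀ _ hΔ
  generalize psi h (x, y) = p at *
  obtain ⟨X, Y⟩ := p
  dsimp only at *
  have hD : Δm h x y = 4*h^2*x^2 + 2*h^2*y^2 - h*y - 1 := rfl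
  generalize Δm h x y = D at *
  unfold phi
  ext
  · rw [div_eq_iff hΔ']
    apply mul_left_cancel₀ (pow_ne_zero 2 hΔ)
    have e₁ : D^2 * (X * (3*h*Y - 1)) = (X*D) * (3*h*(Y*D) - D) := by ring
    have e₂ : D^2 * (x * Δp h X Y) =
        x * (4*h^2*(X*D)^2 + 2*h^2*(Y*D)^2 + h*(Y*D)*D - D^2) := by unfold Δp; ring
    rw [e₁, e₂, hX, hY, hD]
    ring
  · rw [div_eq_iff hΔ']
    apply mul_left_cancel₀ (pow_ne_zero 2 hΔ)
    have e₁ : D^2 * (4*h*X^2 - h*Y^2 - Y) = 4*h*(X*D)^2 - h*(Y*D)^2 - (Y*D)*D := by ring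
    have e₂ : D^2 * (y * Δp h X Y) =
        y * (4*h^2*(X*D)^2 + 2*h^2*(Y*D)^2 + h*(Y*D)*D - D^2) := by unfold Δp; ring
    rw [e₁, e₂, hX, hY, hD]
    ring
end

section
/- Let h be a nonzero complex number and (x,y) complex numbers with Δ₊(x,y) ≠ 0. Write (X,Y) = φ(x,y) and let J(x,y) denote the determinant of the Jacobian matrix of φ at (x,y) (the 2×2 matrix of partial derivatives of the two component functions with respect to x and y). Then J(x,y) · x(x²−y²) = X(X²−Y²). In other words, φ preserves the volume form ω = dx∧dy/(x(x²−y²)). -/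
open Complex

/-- First component of the map `φ`. -/
noncomputable def phi1 (h x y : ℂ) : ℂ := x * (3*h*y - 1) / Δp h x y

/-- Second component of the map `φ`. -/
noncomputable def phi2 (h x y : ℂ) : ℂ := (4*h*x^2 - h*y^2 - y) / Δp h x y

/-- The determinant of the Jacobian matrix of `φ` at `(x,y)`. -/
noncomputable def Jphi (h x y : ℂ) : ℂ :=
  deriv (fun t => phi1 h t y) x * deriv (fun t => phi2 h x t) y -
    deriv (fun t => phi1 h x t) y * deriv (fun t => phi2 h t y) x

lemma hasDerivAt_Δp_left (h x y : ℂ) : HasDerivAt (fun t => Δp h t y) (8*h^2*x) x := by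
  unfold Δp
  refine HasDerivAt.congr_deriv (((((hasDerivAt_pow 2 x).const_mul (4*h^2)).add_const (2*h^2*y^2)).add_const
    (h*y)).sub_const 1) ?_
  norm_num
  ring

lemma hasDerivAt_Δp_right (h x y : ℂ) : HasDerivAt (fun t => Δp h x t) (4*h^2*y + h) y := by
  unfold Δp
  refine HasDerivAt.congr_deriv (((((hasDerivAt_pow 2 y).const_mul (2*h^2)).const_add (4*h^2*x^2)).fun_add
    ((hasDerivAt_id' y).const_mul h)).sub_const 1) ?_
  norm_num
  ring

lemma deriv_phi1_left {h x y : ℂ} (hΔ : Δp h x y ≠ 0) :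
    deriv (fun t => phi1 h t y) x =
      ((3*h*y - 1) * Δp h x y - x * (3*h*y - 1) * (8*h^2*x)) / Δp h x y ^ 2 := by
  refine HasDerivAt.deriv (HasDerivAt.fun_div ?_ (hasDerivAt_Δp_left h x y) hΔ)
  simpa using (hasDerivAt_id' x).mul_const (3*h*y - 1)

lemma deriv_phi1_right {h x y : ℂ} (hΔ : Δp h x y ≠ 0) :
    deriv (fun t => phi1 h x t) y =
      (x * (3*h) * Δp h x y - x * (3*h*y - 1) * (4*h^2*y + h)) / Δp h x y ^ 2 := by
  refine HasDerivAt.deriv (HasDerivAt.fun_div ?_ (hasDerivAt_Δp_right h x y) hΔ)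
  simpa using (((hasDerivAt_id' y).const_mul (3*h)).sub_const 1).const_mul x

lemma deriv_phi2_left {h x y : ℂ} (hΔ : Δp h x y ≠ 0) :
    deriv (fun t => phi2 h t y) x =
      (8*h*x * Δp h x y - (4*h*x^2 - h*y^2 - y) * (8*h^2*x)) / Δp h x y ^ 2 := by
  refine HasDerivAt.deriv (HasDerivAt.fun_div ?_ (hasDerivAt_Δp_left h x y) hΔ)
  refine HasDerivAt.congr_deriv ((((hasDerivAt_pow 2 x).const_mul (4*h)).sub_const (h*y^2)).sub_const y) ?_
  norm_num
  ring

lemma deriv_phi2_right {h x y : ℂ} (hΔ : Δp h x y ≠ 0) :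
    deriv (fun t => phi2 h x t) y =
      ((-2*h*y - 1) * Δp h x y - (4*h*x^2 - h*y^2 - y) * (4*h^2*y + h)) / Δp h x y ^ 2 := by
  refine HasDerivAt.deriv (HasDerivAt.fun_div ?_ (hasDerivAt_Δp_right h x y) hΔ)
  refine HasDerivAt.congr_deriv (((hasDerivAt_pow 2 y).const_mul h |>.const_sub (4*h*x^2)).fun_sub
    (hasDerivAt_id' y)) ?_
  norm_num
  ring

theorem phi_preserves_volume_form (h x y : ℂ) (hh : h ≠ 0)
    (hΔ : Δp h x y ≠ 0) :
    Jphi h x y * (x * (x^2 - y^2)) =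
      phi1 h x y * ((phi1 h x y)^2 - (phi2 h x y)^2) := by
  rw [Jphi, deriv_phi1_left hΔ, deriv_phi1_right hΔ, deriv_phi2_left hΔ, deriv_phi2_right hΔ,
    phi1, phi2]
  field_simp
  unfold Δp
  ring
end

section
/- Let h be a nonzero complex number and (x,y) complex numbers with Δ₋(x,y) ≠ 0. Write (X,Y) = ψ(x,y) and let J(x,y) denote the determinant of the Jacobian matrix of ψ at (x,y) (the 2×2 matrix of partial derivatives of the two component functions with respect to x and y). Then J(x,y) · x(x²−y²) = X(X²−Y²). In other words, ψ preserves the volume form ω = dx∧dy/(x(x²−y²)). -/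
open Complex

/-- First component of the map `ψ`. -/
noncomputable def psi1 (h x y : ℂ) : ℂ := -(x * (3*h*y + 1)) / Δm h x y

/-- Second component of the map `ψ`. -/
noncomputable def psi2 (h x y : ℂ) : ℂ := -(4*h*x^2 - h*y^2 + y) / Δm h x y

/-- The determinant of the Jacobian matrix of `ψ` at `(x,y)`. -/
noncomputable def Jpsi (h x y : ℂ) : ℂ :=
  deriv (fun t => psi1 h t y) x * deriv (fun t => psi2 h x t) y -
    deriv (fun t => psi1 h x t) y * deriv (fun t => psi2 h t y) x

/-- The partial derivative of `Δm` in its first variable. -/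
theorem hasDerivAt_Δm_fst (h x y : ℂ) : HasDerivAt (fun t => Δm h t y) (8*h^2*x) x := by
  unfold Δm
  have := (((((hasDerivAt_id' x).fun_pow 2).const_mul (4*h^2)).add_const
    (2*h^2*y^2)).sub_const (h*y)).sub_const 1
  exact this.congr_deriv (by norm_num; ring)

/-- The partial derivative of `Δm` in its second variable. -/
theorem hasDerivAt_Δm_snd (h x y : ℂ) : HasDerivAt (fun t => Δm h x t) (4*h^2*y - h) y := by
  unfold Δm
  have := (((((hasDerivAt_id' y).fun_pow 2).const_mul (2*h^2)).const_add
    (4*h^2*x^2)).sub ((hasDerivAt_id' y).const_mul h)).sub_const 1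
  exact this.congr_deriv (by norm_num; ring)

theorem deriv_psi1_fst (h x y : ℂ) (hΔ : Δm h x y ≠ 0) :
    deriv (fun t => psi1 h t y) x =
      (-(3*h*y + 1) * Δm h x y + x * (3*h*y + 1) * (8*h^2*x)) / Δm h x y ^ 2 := by
  have := (((hasDerivAt_id' x).mul_const (3*h*y + 1)).fun_neg).fun_div
    (hasDerivAt_Δm_fst h x y) hΔ
  exact (this.congr_deriv (by ring)).deriv

theorem deriv_psi1_snd (h x y : ℂ) (hΔ : Δm h x y ≠ 0) :
    deriv (fun t => psi1 h x t) y =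
      (-(3*h*x) * Δm h x y + x * (3*h*y + 1) * (4*h^2*y - h)) / Δm h x y ^ 2 := by
  have := (((((hasDerivAt_id' y).const_mul (3*h)).add_const 1).const_mul x).fun_neg).fun_div
    (hasDerivAt_Δm_snd h x y) hΔ
  exact (this.congr_deriv (by ring)).deriv

theorem deriv_psi2_fst (h x y : ℂ) (hΔ : Δm h x y ≠ 0) :
    deriv (fun t => psi2 h t y) x =
      (-(8*h*x) * Δm h x y + (4*h*x^2 - h*y^2 + y) * (8*h^2*x)) / Δm h x y ^ 2 := by
  have := ((((((hasDerivAt_id' x).fun_pow 2).const_mul (4*h)).sub_const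
    (h*y^2)).add_const y).fun_neg).fun_div (hasDerivAt_Δm_fst h x y) hΔ
  exact (this.congr_deriv (by norm_num; ring)).deriv

theorem deriv_psi2_snd (h x y : ℂ) (hΔ : Δm h x y ≠ 0) :
    deriv (fun t => psi2 h x t) y =
      ((2*h*y - 1) * Δm h x y + (4*h*x^2 - h*y^2 + y) * (4*h^2*y - h)) / Δm h x y ^ 2 := by
  have := (((((hasDerivAt_id' y).fun_pow 2).const_mul h).const_sub
    (4*h*x^2)).fun_add (hasDerivAt_id' y)).fun_neg.fun_div (hasDerivAt_Δm_snd h x y) hΔ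
  exact (this.congr_deriv (by norm_num; ring)).deriv

theorem psi_preserves_volume_form (h x y : ℂ) (hh : h ≠ 0)
    (hΔ : Δm h x y ≠ 0) :
    Jpsi h x y * (x * (x^2 - y^2)) =
      psi1 h x y * ((psi1 h x y)^2 - (psi2 h x y)^2) := by
  rw [Jpsi, deriv_psi1_fst h x y hΔ, deriv_psi1_snd h x y hΔ, deriv_psi2_fst h x y hΔ,
    deriv_psi2_snd h x y hΔ, psi1, psi2]
  field_simp
  unfold Δm
  ring
end

section
/- Let h be a nonzero complex number and let u, v be complex numbers with u+v ≠ 0, uv ≠ 0, 8h²−uv ≠ 0, and such that, setting x = 2/(u+v) and y = −(u−v)/(h(u+v)), one has (1−h²y²)(1−8h²x²−h²y²) ≠ 0. Then H(x,y) = K(u,v), i.e. under the fractional linear change of variables x = 2/(u+v), y = −(u−v)/(h(u+v)), the quartic invariant H is mapped to the biquadratic (QRT-type) invariant K. -/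
open Complex

/-- The biquadratic QRT-type invariant
`K(u,v) = (1/(4h²)) (u−v−2h)(u−v+2h)/(uv(8h²−uv))`. -/
noncomputable def K (h u v : ℂ) : ℂ :=
  1 / (4*h^2) * ((u - v - 2*h) * (u - v + 2*h) / (u * v * (8*h^2 - u*v)))

theorem H_maps_to_K (h u v : ℂ) (hh : h ≠ 0)
    (huv : u + v ≠ 0) (huv' : u * v ≠ 0) (huv'' : 8*h^2 - u*v ≠ 0)
    (hden : (1 - h^2 * (-(u - v) / (h * (u + v)))^2) *
        (1 - 8*h^2 * (2 / (u + v))^2 - h^2 * (-(u - v) / (h * (u + v)))^2) ≠ 0) :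
    H h (2 / (u + v)) (-(u - v) / (h * (u + v))) = K h u v := by
  have h₁ : 1 - h^2 * (-(u - v) / (h * (u + v)))^2 = 4 * (u * v) / (u + v)^2 := by
    field_simp
    ring
  have h₂ : 1 - 8*h^2 * (2 / (u + v))^2 - h^2 * (-(u - v) / (h * (u + v)))^2 =
      -4 * (8*h^2 - u*v) / (u + v)^2 := by
    field_simp
    ring
  have h₃ : (2 / (u + v))^2 * ((2 / (u + v))^2 - (-(u - v) / (h * (u + v)))^2) =
      -4 * ((u - v - 2*h) * (u - v + 2*h)) / (h^2 * (u + v)^4) := by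
    field_simp
    ring
  rw [H, K, h₁, h₂, h₃]
  generalize 8*h^2 - u*v = w at huv''
  generalize u * v = p at huv'
  field_simp
end

section
/- Let h be a nonzero complex number and u, v complex numbers with u+v ≠ 0, 2u−v ≠ 0, and such that v + v' ≠ 0 where v' = −(8h²−uv)/(2u−v), and such that Δ₊(x,y) ≠ 0 for x = 2/(u+v), y = −(u−v)/(h(u+v)). Then φ(2/(u+v), −(u−v)/(h(u+v))) = (2/(v+v'), −(v−v')/(h(v+v'))). In other words, under the change of variables χ(u,v) = (2/(u+v), −(u−v)/(h(u+v))), the map φ is conjugated to the symmetric QRT map φ̃(u,v) = (v, −(8h²−uv)/(2u−v)), i.e. φ∘χ = χ∘φ̃ wherever both sides are defined. -/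
open Complex

/-- The change of variables `χ(u,v) = (2/(u+v), −(u−v)/(h(u+v)))`. -/
noncomputable def chi (h : ℂ) (p : ℂ × ℂ) : ℂ × ℂ :=
  (2 / (p.1 + p.2), -(p.1 - p.2) / (h * (p.1 + p.2)))

/-- In the coordinates `χ(u,v)` the denominator `Δ₊` is a multiple of `3uv − v² − 8h²`. -/
lemma Δp_chi (h u v : ℂ) (hh : h ≠ 0) (huv : u + v ≠ 0) :
    Δp h (2 / (u + v)) (-(u - v) / (h * (u + v))) =
      -2 * (3*u*v - v^2 - 8*h^2) / (u + v)^2 := by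
  unfold Δp
  field_simp
  ring

theorem phi_conjugate_QRT (h u v : ℂ) (hh : h ≠ 0)
    (huv : u + v ≠ 0) (h2uv : 2*u - v ≠ 0)
    (hvv' : v + -(8*h^2 - u*v) / (2*u - v) ≠ 0)
    (hΔ : Δp h (2 / (u + v)) (-(u - v) / (h * (u + v))) ≠ 0) :
    phi h (chi h (u, v)) = chi h (v, -(8*h^2 - u*v) / (2*u - v)) := by
  have hsum : v + -(8*h^2 - u*v) / (2*u - v) = (3*u*v - v^2 - 8*h^2) / (2*u - v) := by
    rw [eq_div_iff h2uv, add_mul, div_mul_cancel₀ _ h2uv]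
    ring
  have hN : 3*u*v - v^2 - 8*h^2 ≠ 0 := by
    intro hN
    exact hvv' (by rw [hsum, hN, zero_div])
  simp only [phi, chi, Δp_chi h u v hh huv, hsum]
  ext
  · field_simp
    ring
  · field_simp
    ring
end

section
/- Let h be a nonzero complex number and u, v complex numbers with u+v ≠ 0, u−2v ≠ 0, and such that u' + u ≠ 0 where u' = (8h²−uv)/(u−2v), and such that Δ₋(x,y) ≠ 0 for x = 2/(u+v), y = −(u−v)/(h(u+v)). Then ψ(2/(u+v), −(u−v)/(h(u+v))) = (2/(u'+u), −(u'−u)/(h(u'+u))). In other words, under the change of variables χ(u,v) = (2/(u+v), −(u−v)/(h(u+v))), the map ψ is conjugated to the symmetric QRT map ψ̃(u,v) = ((8h²−uv)/(u−2v), u), i.e. ψ∘χ = χ∘ψ̃ wherever both sides are defined. -/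
open Complex

/-- The denominator of `ψ` in the coordinates `(u, v)`. -/
theorem Δm_chi (h u v : ℂ) (hh : h ≠ 0) (huv : u + v ≠ 0) :
    Δm h (2 / (u + v)) (-(u - v) / (h * (u + v))) =
      2 * (8*h^2 + u^2 - 3*u*v) / (u + v)^2 := by
  unfold Δm
  field_simp
  ring

theorem psi_conjugate_QRT (h u v : ℂ) (hh : h ≠ 0)
    (huv : u + v ≠ 0) (hu2v : u - 2*v ≠ 0)
    (huu' : (8*h^2 - u*v) / (u - 2*v) + u ≠ 0)
    (hΔ : Δm h (2 / (u + v)) (-(u - v) / (h * (u + v))) ≠ 0) :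
    psi h (chi h (u, v)) = chi h ((8*h^2 - u*v) / (u - 2*v), u) := by
  have hD := Δm_chi h u v hh huv
  have hN : 8*h^2 + u^2 - 3*u*v ≠ 0 := by
    intro h0
    apply hΔ
    rw [hD, h0, mul_zero, zero_div]
  have hadd : (8*h^2 - u*v) / (u - 2*v) + u = (8*h^2 + u^2 - 3*u*v) / (u - 2*v) := by
    rw [div_add' _ _ _ hu2v]
    ring
  have hsub : (8*h^2 - u*v) / (u - 2*v) - u = (8*h^2 - u^2 + u*v) / (u - 2*v) := by
    rw [div_sub' hu2v]
    ring
  simp only [psi, chi, hD, hadd, hsub, Prod.mk.injEq]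
  constructor
  · field_simp
    ring
  · field_simp
    ring
end

section
/- Let h be a nonzero complex number and u, v complex numbers with 2u−v ≠ 0, uv ≠ 0, 8h²−uv ≠ 0, and such that, writing v' = −(8h²−uv)/(2u−v), also vv' ≠ 0 and 8h²−vv' ≠ 0. Then K(v, v') = K(u,v), i.e. K is an invariant of the QRT map φ̃(u,v) = (v, −(8h²−uv)/(2u−v)). -/
open Complex

theorem K_invariant_QRT (h u v : ℂ) (hh : h ≠ 0)
    (h2uv : 2*u - v ≠ 0) (huv : u * v ≠ 0) (huv' : 8*h^2 - u*v ≠ 0)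
    (hvv' : v * (-(8*h^2 - u*v) / (2*u - v)) ≠ 0)
    (hvv'' : 8*h^2 - v * (-(8*h^2 - u*v) / (2*u - v)) ≠ 0) :
    K h v (-(8*h^2 - u*v) / (2*u - v)) = K h u v := by
  obtain ⟨w, hw⟩ : ∃ w, w = -(8*h^2 - u*v) / (2*u - v) := ⟨_, rfl⟩
  rw [← hw] at hvv' hvv'' ⊢
  have hwD : w * (2*u - v) = -(8*h^2 - u*v) := by rw [hw, div_mul_cancel₀ _ h2uv]
  have hnum : (v - w - 2*h) * (v - w + 2*h) * (2*u - v)^2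
      = (u - v - 2*h) * (u - v + 2*h) * (v^2 - 16*h^2) := by
    have hdiff : (v - w) * (2*u - v) = v * (u - v) + 8*h^2 := by linear_combination -hwD
    linear_combination ((v - w) * (2*u - v) + v * (u - v) + 8*h^2) * hdiff
  have hden : v * w * (8*h^2 - v*w) * (2*u - v)^2
      = u * v * (8*h^2 - u*v) * (v^2 - 16*h^2) := by
    have hfac : (8*h^2 - v*w) * (2*u - v) = u * (16*h^2 - v^2) := by
      linear_combination -v * hwD
    linear_combination v * (w * (2*u - v)) * hfac + v * (u * (16*h^2 - v^2)) * hwD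
  have hv : v^2 - 16*h^2 ≠ 0 := by
    refine right_ne_zero_of_mul (a := u * v * (8*h^2 - u*v)) ?_
    rw [← hden]
    exact mul_ne_zero (mul_ne_zero hvv' hvv'') (pow_ne_zero 2 h2uv)
  unfold K
  rw [← mul_div_mul_right _ (v * w * (8*h^2 - v*w)) (pow_ne_zero 2 h2uv), hnum, hden,
    mul_div_mul_right _ _ hv]
end

section
/- Let h be a nonzero complex number, ε a complex number, and u, v complex numbers with u+v ≠ 0. Set x = 2/(u+v) and y = −(u−v)/(h(u+v)). Then p(x,y) = −4·q(u,v)/(h²(u+v)⁴), where p(x,y) = x²(x²−y²) + ε(1−h²y²)(1−8h²x²−h²y²) and q(u,v) = (u−v−2h)(u−v+2h) + 4εh²uv(8h²−uv). Equivalently, p(x,y) = −(x⁴/(4h²))·q(u,v), so the quartic pencil p and the biquadratic pencil q are equivalent up to the multiple singular fibre x⁴. -/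
open Complex

/-- The quartic pencil `p(x,y) = x²(x²−y²) + ε(1−h²y²)(1−8h²x²−h²y²)`. -/
def pPencil (h ε x y : ℂ) : ℂ :=
  x^2 * (x^2 - y^2) + ε * (1 - h^2*y^2) * (1 - 8*h^2*x^2 - h^2*y^2)

/-- The biquadratic pencil `q(u,v) = (u−v−2h)(u−v+2h) + 4εh²uv(8h²−uv)`. -/
def qPencil (h ε u v : ℂ) : ℂ :=
  (u - v - 2*h) * (u - v + 2*h) + 4*ε*h^2 * (u*v) * (8*h^2 - u*v)

theorem pencil_factorisation (h ε u v : ℂ) (hh : h ≠ 0) (huv : u + v ≠ 0) :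
    pPencil h ε (2 / (u + v)) (-(u - v) / (h * (u + v))) =
        -(4 * qPencil h ε u v) / (h^2 * (u + v)^4) ∧
    pPencil h ε (2 / (u + v)) (-(u - v) / (h * (u + v))) =
        -((2 / (u + v))^4 / (4*h^2)) * qPencil h ε u v := by
  unfold pPencil qPencil
  constructor <;>
  · field_simp
    ring
end

section
/- Let h be a nonzero complex number, a a complex number, and n a natural number. Assume that 1 − m·a·h ≠ 0 for every integer m with −1 ≤ m ≤ 2n. Then the n-th iterate of φ satisfies φⁿ(0, a) = (0, a/(1−2anh)); in particular, the line {x = 0} carries the one-parameter family of solutions y_n = a/(1−2anh). -/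
open Complex

theorem phi_zero_left (h y : ℂ) (hy : 1 + h * y ≠ 0) :
    phi h (0, y) = (0, y / (1 - 2 * h * y)) := by
  have hnum : 4 * h * (0 : ℂ) ^ 2 - h * y ^ 2 - y = y * -(1 + h * y) := by ring
  have hΔ : Δp h 0 y = (1 - 2 * h * y) * -(1 + h * y) := by
    unfold Δp
    ring
  simp only [phi, hnum, hΔ, zero_mul, zero_div, mul_div_mul_right _ _ (neg_ne_zero.mpr hy)]

theorem phi_orbit_on_line_x_eq_zero (h a : ℂ) (n : ℕ) (hh : h ≠ 0)
    (hden : ∀ m : ℤ, -1 ≤ m → m ≤ 2 * (n : ℤ) → 1 - (m : ℂ) * a * h ≠ 0) :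
    (phi h)^[n] (0, a) = (0, a / (1 - 2 * a * (n : ℂ) * h)) := by
  induction n with
  | zero => simp
  | succ k ih =>
    have h_prev : 1 - (2 * k - 1) * a * h ≠ 0 := by
      simpa using hden (2 * k - 1) (by lia) (by lia)
    have h_cur : 1 - 2 * a * k * h ≠ 0 := by
      have := hden (2 * k) (by lia) (by lia)
      push_cast at this
      convert this using 2
      ring
    have h_add : 1 + h * (a / (1 - 2 * a * k * h)) =
        (1 - (2 * k - 1) * a * h) / (1 - 2 * a * k * h) := by
      rw [eq_div_iff h_cur, add_mul, ← mul_div_assoc, div_mul_cancel₀ _ h_cur]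
      ring
    have h_sub : 1 - 2 * h * (a / (1 - 2 * a * k * h)) =
        (1 - 2 * a * (k + 1) * h) / (1 - 2 * a * k * h) := by
      rw [eq_div_iff h_cur, sub_mul, ← mul_div_assoc, div_mul_cancel₀ _ h_cur]
      ring
    rw [Function.iterate_succ_apply', ih fun m hm hmk => hden m hm (by push_cast; lia),
      phi_zero_left _ _ (h_add ▸ div_ne_zero h_prev h_cur), h_sub,
      div_div_div_cancel_right₀ h_cur]
    push_cast
    rfl
end

section
/- Let h be a nonzero complex number, a a complex number, and n a natural number. Assume that 1 + m·a·h ≠ 0 for every integer m with −1 ≤ m ≤ 2n. Then the n-th iterate of ψ satisfies ψⁿ(0, a) = (0, a/(1+2anh)); in particular, the line {x = 0} carries the one-parameter family of solutions y_n = a/(1+2anh). -/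
open Complex

theorem Δm_zero_left (h y : ℂ) : Δm h 0 y = (h * y - 1) * (2 * h * y + 1) := by
  unfold Δm
  ring

/-- On the line `x = 0` the map `ψ` reduces to `y ↦ y / (1 + 2hy)`. -/
theorem psi_zero_left (h y : ℂ) (hy : h * y - 1 ≠ 0) :
    psi h (0, y) = (0, y / (2 * h * y + 1)) := by
  have hnum : -(4 * h * (0 : ℂ) ^ 2 - h * y ^ 2 + y) = (h * y - 1) * y := by ring
  simp only [psi, Δm_zero_left, hnum, mul_div_mul_left _ _ hy, zero_mul, neg_zero, zero_div]

theorem psi_orbit_on_line_x_eq_zero (h a : ℂ) (n : ℕ) (hh : h ≠ 0)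
    (hden : ∀ m : ℤ, -1 ≤ m → m ≤ 2 * (n : ℤ) → 1 + (m : ℂ) * a * h ≠ 0) :
    (psi h)^[n] (0, a) = (0, a / (1 + 2 * a * (n : ℂ) * h)) := by
  induction n with
  | zero => simp
  | succ k ih =>
    have hk : 1 + 2 * a * (k : ℂ) * h ≠ 0 := by
      have := hden (2 * k) (by lia) (by push_cast; lia)
      push_cast at this
      convert this using 1
      ring
    have hpred : 1 + (2 * (k : ℂ) - 1) * a * h ≠ 0 := by
      have := hden (2 * k - 1) (by lia) (by push_cast; lia)
      push_cast at this
      exact this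
    have hsucc : 1 + 2 * a * ((k : ℂ) + 1) * h ≠ 0 := by
      have := hden (2 * k + 2) (by lia) (by push_cast; lia)
      push_cast at this
      convert this using 1
      ring
    have hfactor : h * (a / (1 + 2 * a * (k : ℂ) * h)) - 1 =
        -(1 + (2 * (k : ℂ) - 1) * a * h) / (1 + 2 * a * (k : ℂ) * h) := by
      rw [eq_div_iff hk, sub_mul, mul_assoc, div_mul_cancel₀ _ hk]
      ring
    have hden' : 2 * h * (a / (1 + 2 * a * (k : ℂ) * h)) + 1 =
        (1 + 2 * a * ((k : ℂ) + 1) * h) / (1 + 2 * a * (k : ℂ) * h) := by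
      rw [eq_div_iff hk, add_mul, mul_assoc, div_mul_cancel₀ _ hk]
      ring
    rw [Function.iterate_succ_apply', ih fun m hm hm' => hden m hm (by push_cast; lia),
      psi_zero_left, hden', div_div_div_cancel_right₀ hk, Nat.cast_succ]
    rw [hfactor]
    exact div_ne_zero (neg_ne_zero.mpr hpred) hk
end

section
/- Let h be a nonzero complex number and define θ_k = (0, 1/(2kh)) for every nonzero integer k. Then: (i) for every integer k with k ≠ 0 and k ≠ 1, Δ₊(0, 1/(2kh)) ≠ 0 and φ(θ_k) = θ_{k−1}; (ii) for every integer k with k ≠ 0 and k ≠ −1, Δ₋(0, 1/(2kh)) ≠ 0 and ψ(θ_k) = θ_{k+1}. Hence the points θ_k form a single infinite orbit along the line {x=0}, shifted down by φ and up by ψ. -/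
open Complex

/-- The points `θ_k = (0, 1/(2kh))` on the line `{x = 0}`. -/
noncomputable def theta (h : ℂ) (k : ℤ) : ℂ × ℂ := (0, 1 / (2 * (k : ℂ) * h))

theorem Δp_theta {h : ℂ} (hh : h ≠ 0) {k : ℤ} (hk : k ≠ 0) :
    Δp h 0 (1 / (2 * (k : ℂ) * h)) = -((2 * k + 1) * (k - 1)) / (2 * (k : ℂ) ^ 2) := by
  have hk' : (k : ℂ) ≠ 0 := mod_cast hk
  unfold Δp
  field_simp
  ring

theorem Δm_theta {h : ℂ} (hh : h ≠ 0) {k : ℤ} (hk : k ≠ 0) :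
    Δm h 0 (1 / (2 * (k : ℂ) * h)) = -((2 * k - 1) * (k + 1)) / (2 * (k : ℂ) ^ 2) := by
  have hk' : (k : ℂ) ≠ 0 := mod_cast hk
  unfold Δm
  field_simp
  ring

theorem theta_orbit (h : ℂ) (hh : h ≠ 0) :
    (∀ k : ℤ, k ≠ 0 → k ≠ 1 →
        Δp h 0 (1 / (2 * (k : ℂ) * h)) ≠ 0 ∧ phi h (theta h k) = theta h (k - 1)) ∧
    (∀ k : ℤ, k ≠ 0 → k ≠ -1 →
        Δm h 0 (1 / (2 * (k : ℂ) * h)) ≠ 0 ∧ psi h (theta h k) = theta h (k + 1)) := by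
  constructor
  · intro k hk hk1
    have hk' : (k : ℂ) ≠ 0 := mod_cast hk
    have h_sub : (k : ℂ) - 1 ≠ 0 := sub_ne_zero.2 (mod_cast hk1)
    have h_odd : 2 * (k : ℂ) + 1 ≠ 0 := by
      have : 2 * k + 1 ≠ 0 := by lia
      exact_mod_cast this
    refine ⟨?_, Prod.ext ?_ ?_⟩
    · rw [Δp_theta hh hk]
      simp [hk', h_sub, h_odd]
    · simp [phi, theta]
    · simp only [phi, theta, Δp_theta hh hk]
      push_cast
      field_simp
      ring
  · intro k hk hk1
    have hk' : (k : ℂ) ≠ 0 := mod_cast hk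
    have h_add : (k : ℂ) + 1 ≠ 0 := by
      have : k + 1 ≠ 0 := by lia
      exact_mod_cast this
    have h_odd : 2 * (k : ℂ) - 1 ≠ 0 := by
      have : 2 * k - 1 ≠ 0 := by lia
      exact_mod_cast this
    refine ⟨?_, Prod.ext ?_ ?_⟩
    · rw [Δm_theta hh hk]
      simp [hk', h_add, h_odd]
    · simp [psi, theta]
    · simp only [psi, theta, Δm_theta hh hk]
      push_cast
      field_simp
      ring
end

section
/- Let M be the 15×15 integer matrix of the induced action φ* on the Picard lattice (defined in the context). Then for every natural number N, the coefficient of H_x in M^N·H_y equals α_N − β_N, where α_N = (2/3)N² + 11/9 − (2/9)cos(2πN/3) and β_N = 1/3 + (2/3)cos(2πN/3); equivalently β_N = 1 if 3 divides N and β_N = 0 otherwise, so that β_N ∈ {0,1} for all N and hence the degree of the N-th iterate of φ is d_N = max(α_N, α_N − β_N) = α_N. -/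
/-- Columns of the matrix of the action `φ*` on the Picard lattice
`Pic(S) = ℤH_x ⊕ ℤH_y ⊕ ℤE_1 ⊕ ⋯ ⊕ ℤE_13`, with basis ordered as
`H_x, H_y, E_1, …, E_13`.  The `j`-th column is the image of the `j`-th
basis vector under `φ*`:
`H_x ↦ 2H_x+2H_y−E_3−E_4−2E_5−E_10`, `H_y ↦ 2H_x+2H_y−E_3−E_4−2E_5−E_10−E_11`,
`E_1 ↦ H_x+H_y−E_3−E_4−E_5`, `E_2 ↦ H_x−E_5`, `E_3 ↦ E_6`, `E_4 ↦ E_7`,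
`E_5 ↦ 2H_x+2H_y−E_3−E_4−2E_5−E_10−E_11`, `E_6 ↦ E_9`, `E_7 ↦ E_8`,
`E_8 ↦ E_12`, `E_9 ↦ E_13`, `E_10 ↦ E_1`, `E_11 ↦ E_2`,
`E_12 ↦ H_x+H_y−E_3−E_5−E_10`, `E_13 ↦ H_x+H_y−E_4−E_5−E_10`. -/
def picardCols : Fin 15 → Fin 15 → ℤ :=
  ![![2, 2, 0, 0, -1, -1, -2, 0, 0, 0, 0, -1, 0, 0, 0],   -- φ*(H_x)
    ![2, 2, 0, 0, -1, -1, -2, 0, 0, 0, 0, -1, -1, 0, 0],  -- φ*(H_y)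
    ![1, 1, 0, 0, -1, -1, -1, 0, 0, 0, 0, 0, 0, 0, 0],    -- φ*(E_1)
    ![1, 0, 0, 0, 0, 0, -1, 0, 0, 0, 0, 0, 0, 0, 0],      -- φ*(E_2)
    ![0, 0, 0, 0, 0, 0, 0, 1, 0, 0, 0, 0, 0, 0, 0],       -- φ*(E_3) = E_6
    ![0, 0, 0, 0, 0, 0, 0, 0, 1, 0, 0, 0, 0, 0, 0],       -- φ*(E_4) = E_7
    ![2, 2, 0, 0, -1, -1, -2, 0, 0, 0, 0, -1, -1, 0, 0],  -- φ*(E_5)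
    ![0, 0, 0, 0, 0, 0, 0, 0, 0, 0, 1, 0, 0, 0, 0],       -- φ*(E_6) = E_9
    ![0, 0, 0, 0, 0, 0, 0, 0, 0, 1, 0, 0, 0, 0, 0],       -- φ*(E_7) = E_8
    ![0, 0, 0, 0, 0, 0, 0, 0, 0, 0, 0, 0, 0, 1, 0],       -- φ*(E_8) = E_12
    ![0, 0, 0, 0, 0, 0, 0, 0, 0, 0, 0, 0, 0, 0, 1],       -- φ*(E_9) = E_13
    ![0, 0, 1, 0, 0, 0, 0, 0, 0, 0, 0, 0, 0, 0, 0],       -- φ*(E_10) = E_1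
    ![0, 0, 0, 1, 0, 0, 0, 0, 0, 0, 0, 0, 0, 0, 0],       -- φ*(E_11) = E_2
    ![1, 1, 0, 0, -1, 0, -1, 0, 0, 0, 0, -1, 0, 0, 0],    -- φ*(E_12)
    ![1, 1, 0, 0, 0, -1, -1, 0, 0, 0, 0, -1, 0, 0, 0]]    -- φ*(E_13)

/-- The matrix `M` of the induced action `φ*` on the Picard lattice,
acting on coordinate (column) vectors:  `M.mulVec` applied to the `j`-th
standard basis vector gives the image of the `j`-th basis element. -/
def picardM : Matrix (Fin 15) (Fin 15) ℤ :=
  Matrix.of fun i j => picardCols j i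

/-- `α_N = (2/3)N² + 11/9 − (2/9)cos(2πN/3)`. -/
noncomputable def alphaN (N : ℕ) : ℝ :=
  (2/3) * (N : ℝ)^2 + 11/9 - (2/9) * Real.cos (2 * Real.pi * N / 3)

/-- `β_N = 1/3 + (2/3)cos(2πN/3)`. -/
noncomputable def betaN (N : ℕ) : ℝ :=
  1/3 + (2/3) * Real.cos (2 * Real.pi * N / 3)

open Matrix

/-- Twice the coordinates of `M ^ (3 * k) • H_y`. -/
def twiceOrbitZero (k : ℤ) : Fin 15 → ℤ :=
  ![12*k^2, 12*k^2 + 2, -6*k^2 + 2*k, 0, -3*k*(k+1), -3*k*(k+1), -12*k^2,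
    -k*(3*k+1), -k*(3*k+1), -k*(3*k-1), -k*(3*k-1), -6*k^2 - 2*k, 0,
    -3*k*(k-1), -3*k*(k-1)]

/-- Twice the coordinates of `M ^ (3 * k + 1) • H_y`. -/
def twiceOrbitOne (k : ℤ) : Fin 15 → ℤ :=
  ![12*k^2 + 8*k + 4, 12*k^2 + 8*k + 4, -6*k^2 - 2*k, 0, -(k+1)*(3*k+2), -(k+1)*(3*k+2),
    -(12*k^2 + 8*k + 4), -3*k*(k+1), -3*k*(k+1), -k*(3*k+1), -k*(3*k+1),
    -6*k^2 - 6*k - 2, -2, -k*(3*k-1), -k*(3*k-1)]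

/-- Twice the coordinates of `M ^ (3 * k + 2) • H_y`. -/
def twiceOrbitTwo (k : ℤ) : Fin 15 → ℤ :=
  ![12*k^2 + 16*k + 8, 12*k^2 + 16*k + 8, -6*k^2 - 6*k - 2, -2, -(k+1)*(3*k+4),
    -(k+1)*(3*k+4), -(12*k^2 + 16*k + 8), -(k+1)*(3*k+2), -(k+1)*(3*k+2), -3*k*(k+1),
    -3*k*(k+1), -6*k^2 - 10*k - 4, 0, -k*(3*k+1), -k*(3*k+1)]

/-- The action of `picardM` on coordinate vectors, written out. -/
lemma picardM_mulVec (v : Fin 15 → ℤ) :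
    picardM *ᵥ v =
      ![2*v 0 + 2*v 1 + v 2 + v 3 + 2*v 6 + v 13 + v 14,
        2*v 0 + 2*v 1 + v 2 + 2*v 6 + v 13 + v 14,
        v 11, v 12,
        -v 0 - v 1 - v 2 - v 6 - v 13,
        -v 0 - v 1 - v 2 - v 6 - v 14,
        -2*v 0 - 2*v 1 - v 2 - v 3 - 2*v 6 - v 13 - v 14,
        v 4, v 5, v 8, v 7,
        -v 0 - v 1 - v 6 - v 13 - v 14,
        -v 1 - v 6, v 9, v 10] := by
  ext i
  fin_cases i <;>
    simp [picardM, picardCols, mulVec, dotProduct, Fin.sum_univ_succ] <;> ring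

lemma picardM_mulVec_twiceOrbitZero (k : ℤ) :
    picardM *ᵥ twiceOrbitZero k = twiceOrbitOne k := by
  rw [picardM_mulVec]
  ext i
  fin_cases i <;> simp [twiceOrbitZero, twiceOrbitOne] <;> ring

lemma picardM_mulVec_twiceOrbitOne (k : ℤ) :
    picardM *ᵥ twiceOrbitOne k = twiceOrbitTwo k := by
  rw [picardM_mulVec]
  ext i
  fin_cases i <;> simp [twiceOrbitOne, twiceOrbitTwo] <;> ring

lemma picardM_mulVec_twiceOrbitTwo (k : ℤ) :
    picardM *ᵥ twiceOrbitTwo k = twiceOrbitZero (k + 1) := by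
  rw [picardM_mulVec]
  ext i
  fin_cases i <;>
    simp [twiceOrbitTwo, twiceOrbitZero, -mul_eq_mul_left_iff, -mul_eq_mul_right_iff] <;> ring

lemma picardM_pow_three_mul_mulVec (k : ℕ) :
    picardM ^ (3 * k) *ᵥ twiceOrbitZero 0 = twiceOrbitZero k := by
  induction k with
  | zero => simp
  | succ k ih =>
    rw [show 3 * (k + 1) = 3 * k + 1 + 1 + 1 by ring, pow_succ', pow_succ', pow_succ',
      ← mulVec_mulVec, ← mulVec_mulVec, ← mulVec_mulVec, ih,
      picardM_mulVec_twiceOrbitZero, picardM_mulVec_twiceOrbitOne, picardM_mulVec_twiceOrbitTwo]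
    simp

lemma two_mul_apply_zero_one (A : Matrix (Fin 15) (Fin 15) ℤ) :
    2 * A 0 1 = (A *ᵥ twiceOrbitZero 0) 0 := by
  have h : twiceOrbitZero 0 = Pi.single 1 2 := by decide
  rw [h, mulVec_single]
  simp [mul_comm]

lemma two_mul_picardM_pow_three_mul (k : ℕ) :
    2 * (picardM ^ (3 * k)) 0 1 = 12 * (k : ℤ)^2 := by
  rw [two_mul_apply_zero_one, picardM_pow_three_mul_mulVec]
  simp [twiceOrbitZero]

lemma two_mul_picardM_pow_three_mul_add_one (k : ℕ) :
    2 * (picardM ^ (3 * k + 1)) 0 1 = 12 * (k : ℤ)^2 + 8 * k + 4 := by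
  rw [two_mul_apply_zero_one, pow_succ', ← mulVec_mulVec, picardM_pow_three_mul_mulVec,
    picardM_mulVec_twiceOrbitZero]
  simp [twiceOrbitOne]

lemma two_mul_picardM_pow_three_mul_add_two (k : ℕ) :
    2 * (picardM ^ (3 * k + 2)) 0 1 = 12 * (k : ℤ)^2 + 16 * k + 8 := by
  rw [two_mul_apply_zero_one, pow_succ', pow_succ', ← mulVec_mulVec, ← mulVec_mulVec,
    picardM_pow_three_mul_mulVec, picardM_mulVec_twiceOrbitZero, picardM_mulVec_twiceOrbitOne]
  simp [twiceOrbitTwo]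

lemma cos_two_pi_mul_three_mul_add_div_three (k r : ℕ) :
    Real.cos (2 * Real.pi * ((3 * k + r : ℕ) : ℝ) / 3) = Real.cos (2 * Real.pi * r / 3) := by
  rw [← Real.cos_add_nat_mul_two_pi (2 * Real.pi * r / 3) k]
  congr 1
  push_cast
  ring

lemma cos_two_pi_mul_one_div_three : Real.cos (2 * Real.pi * (1 : ℕ) / 3) = -1 / 2 := by
  rw [show 2 * Real.pi * (1 : ℕ) / 3 = Real.pi - Real.pi / 3 by push_cast; ring,
    Real.cos_pi_sub, Real.cos_pi_div_three]
  norm_num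

lemma cos_two_pi_mul_two_div_three : Real.cos (2 * Real.pi * (2 : ℕ) / 3) = -1 / 2 := by
  rw [show 2 * Real.pi * (2 : ℕ) / 3 = Real.pi / 3 + Real.pi by push_cast; ring,
    Real.cos_add_pi, Real.cos_pi_div_three]
  norm_num

theorem picard_offdiagonal_degree_growth (N : ℕ) :
    (((picardM ^ N) 0 1 : ℤ) : ℝ) = alphaN N - betaN N ∧
    betaN N = (if (3 : ℕ) ∣ N then 1 else 0) ∧
    (betaN N = 0 ∨ betaN N = 1) ∧
    max (alphaN N) (alphaN N - betaN N) = alphaN N := by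
  have key : (((picardM ^ N) 0 1 : ℤ) : ℝ) = alphaN N - betaN N ∧
      betaN N = (if (3 : ℕ) ∣ N then 1 else 0) := by
    obtain ⟨k, rfl | rfl | rfl⟩ : ∃ k, N = 3 * k + 0 ∨ N = 3 * k + 1 ∨ N = 3 * k + 2 :=
      ⟨N / 3, by omega⟩
    · have h := congrArg (Int.cast : ℤ → ℝ) (two_mul_picardM_pow_three_mul k)
      rw [alphaN, betaN, cos_two_pi_mul_three_mul_add_div_three, if_pos (by omega)]
      push_cast at h ⊢
      simp only [add_zero, mul_zero, zero_div, Real.cos_zero]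
      constructor <;> linarith
    · have h := congrArg (Int.cast : ℤ → ℝ) (two_mul_picardM_pow_three_mul_add_one k)
      rw [alphaN, betaN, cos_two_pi_mul_three_mul_add_div_three, cos_two_pi_mul_one_div_three,
        if_neg (by omega)]
      push_cast at h ⊢
      constructor <;> linarith
    · have h := congrArg (Int.cast : ℤ → ℝ) (two_mul_picardM_pow_three_mul_add_two k)
      rw [alphaN, betaN, cos_two_pi_mul_three_mul_add_div_three, cos_two_pi_mul_two_div_three,
        if_neg (by omega)]
      push_cast at h ⊢
      constructor <;> linarith
  refine ⟨key.1, key.2, ?_, max_eq_left ?_⟩ <;> rw [key.2] <;> split_ifs <;> simp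
end

section
/- Let M be the 15×15 integer matrix of the induced action φ* on the Picard lattice (defined in the context). Then the four classes D_1 = H_x+H_y−E_4−E_5−E_7−E_8−E_12, D_2 = H_x+H_y−E_3−E_5−E_6−E_9−E_13, D_3 = H_y−E_1−E_2−E_10−E_11, and D_4 = E_1−E_3−E_6−E_9+E_10−E_13 are all fixed by M, i.e. M·D_i = D_i for i = 1,2,3,4; they generate the eigenspace of M with eigenvalue 1. Moreover D_1 + 3D_2 − 2D_4 = 4H_x + 4H_y − 2E_1 − E_3 − E_4 − 4E_5 − E_6 − E_7 − E_8 − E_9 − 2E_10 − E_12 − E_13. -/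
/-- `D_1 = H_x+H_y−E_4−E_5−E_7−E_8−E_12`. -/
def D1 : Fin 15 → ℤ := ![1, 1, 0, 0, 0, -1, -1, 0, -1, -1, 0, 0, 0, -1, 0]

/-- `D_2 = H_x+H_y−E_3−E_5−E_6−E_9−E_13`. -/
def D2 : Fin 15 → ℤ := ![1, 1, 0, 0, -1, 0, -1, -1, 0, 0, -1, 0, 0, 0, -1]

/-- `D_3 = H_y−E_1−E_2−E_10−E_11`. -/
def D3 : Fin 15 → ℤ := ![0, 1, -1, -1, 0, 0, 0, 0, 0, 0, 0, -1, -1, 0, 0]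

/-- `D_4 = E_1−E_3−E_6−E_9+E_10−E_13`. -/
def D4 : Fin 15 → ℤ := ![0, 0, 1, 0, -1, 0, 0, -1, 0, 0, -1, 1, 0, 0, -1]

theorem picard_eigenspace_one :
    (picardM.mulVec D1 = D1 ∧ picardM.mulVec D2 = D2 ∧
     picardM.mulVec D3 = D3 ∧ picardM.mulVec D4 = D4) ∧
    (∀ v : Fin 15 → ℚ,
      (picardM.map (Int.cast : ℤ → ℚ)).mulVec v = v ↔
        v ∈ Submodule.span ℚ
          ({fun i => (D1 i : ℚ), fun i => (D2 i : ℚ),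
            fun i => (D3 i : ℚ), fun i => (D4 i : ℚ)} : Set (Fin 15 → ℚ))) ∧
    (fun i => D1 i + 3 * D2 i - 2 * D4 i) =
      ![4, 4, -2, 0, -1, -1, -4, -1, -1, -1, -1, -2, 0, -1, -1] := by
  refine ⟨⟨by decide +kernel, by decide +kernel, by decide +kernel, by decide +kernel⟩,
    fun v => ?_, by decide +kernel⟩
  simp only [Submodule.mem_span_insert, Submodule.mem_span_singleton]
  constructor
  · intro h
    have coords := fun i => congrFun h i
    simp only [Fin.forall_fin_succ, Matrix.mulVec, dotProduct, Fin.sum_univ_succ] at coords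
    simp [picardM, picardCols] at coords
    refine ⟨-v 13, _, ⟨-v 14 - v 11 + v 12, _, ⟨-v 12, _, ⟨v 11 - v 12, rfl⟩, rfl⟩, rfl⟩, ?_⟩
    ext i
    fin_cases i <;> simp [D1, D2, D3, D4] <;> grind
  · rintro ⟨a, _, ⟨b, _, ⟨c, _, ⟨d, rfl⟩, rfl⟩, rfl⟩, rfl⟩
    ext i
    fin_cases i <;>
      simp [Matrix.mulVec, dotProduct, Fin.sum_univ_succ, picardM, picardCols, D1, D2, D3, D4] <;>
      ring
end
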